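/- arXiv:1803.03881 — 5 statements merged into one kernel-verified Lean document; each statement's English description precedes it below -/
import Mathlib

section
/- For every real number x with 0 < x ≤ 1/2, the polynomial inequality 8 − 24x − 54x² + 108x³ + 513x⁴ − 891x⁵ > 0 holds. -/
/-- For every real number `x` with `0 < x ≤ 1/2`, the polynomial inequality
`8 − 24x − 54x² + 108x³ + 513x⁴ − 891x⁵ > 0` holds. -/
theorem schwarzschild_H0_morawetz_zeroth_order_positive (x : ℝ) (hx0 : 0 < x)
    (hx1 : x ≤ 1 / 2) :
    8 - 24 * x - 54 * x ^ 2 + 108 * x ^ 3 + 513 * x ^ 4 - 891 * x ^ 5 > 0 := by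
  have hy : 0 ≤ 1 / 2 - x := by linarith
  nlinarith [mul_nonneg hx0.le (sq_nonneg (x ^ 2 - 1 / 4)),
    mul_nonneg hy (sq_nonneg (x ^ 2 - 4 / 25))]
end

section
/- Let M > 0. For a twice continuously differentiable function w : (2M, ∞) → ℝ define the radial Schwarzschild d'Alembertian □_M w(r) := (1 − 2M/r)·w''(r) + (2(r − M)/r²)·w'(r). Set f(r) := (1 + 3M/(2r))²(1 − 3M/r), ω(r) := (1 − 2M/r)·(f'(r) + 2f(r)/r), and V₀(r) := (1/r²)(1 − 2M/r). Then for every r > 2M one has the identity −(1/4)·□_M ω(r) − (1/2)·f(r)·(1 − 2M/r)·V₀'(r) − (M/r²)·f(r)·V₀(r) + (f(r)/r³)·(1 − 3M/r) = (1/(4r³))·(8 − 24(M/r) − 54(M/r)² + 108(M/r)³ + 513(M/r)⁴ − 891(M/r)⁵). -/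
open Real

/-- The radial Schwarzschild d'Alembertian applied to a radial function `w`:
`□_M w(r) = (1 − 2M/r)·w''(r) + (2(r − M)/r²)·w'(r)`. -/
noncomputable def radialBox (M : ℝ) (w : ℝ → ℝ) (r : ℝ) : ℝ :=
  (1 - 2 * M / r) * deriv (deriv w) r + (2 * (r - M) / r ^ 2) * deriv w r

/-- The Morawetz multiplier `f(r) = (1 + 3M/(2r))²(1 − 3M/r)` for `H₀`. -/
noncomputable def morawetzF (M r : ℝ) : ℝ :=
  (1 + 3 * M / (2 * r)) ^ 2 * (1 - 3 * M / r)

/-- The deformation weight `ω(r) = (1 − 2M/r)(f'(r) + 2f(r)/r)`. -/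
noncomputable def morawetzOmega (M r : ℝ) : ℝ :=
  (1 - 2 * M / r) * (deriv (morawetzF M) r + 2 * morawetzF M r / r)

/-- The potential `V₀(r) = (1/r²)(1 − 2M/r)`. -/
noncomputable def schwarzschildV0 (M r : ℝ) : ℝ :=
  (1 / r ^ 2) * (1 - 2 * M / r)

/-- The derivative of `c / yⁿ` away from the origin. -/
theorem hasDerivAt_const_div_pow (c : ℝ) (n : ℕ) {r : ℝ} (hr : r ≠ 0) :
    HasDerivAt (fun y : ℝ => c / y ^ n) (-(n * c) / r ^ (n + 1)) r := by
  have h := ((hasDerivAt_pow n r).fun_inv (pow_ne_zero n hr)).const_mul c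
  simp only [← div_eq_mul_inv] at h
  refine h.congr_deriv ?_
  cases n with
  | zero => simp
  | succ k =>
    simp only [Nat.add_sub_cancel]
    field_simp
    ring

theorem deriv_morawetzF (M : ℝ) {r : ℝ} (hr : r ≠ 0) :
    deriv (morawetzF M) r = 27 / 2 * M ^ 2 / r ^ 3 + 81 / 4 * M ^ 3 / r ^ 4 := by
  have heq : morawetzF M =ᶠ[nhds r]
      fun y => 1 + -(27 / 4 * M ^ 2) / y ^ 2 + -(27 / 4 * M ^ 3) / y ^ 3 := by
    filter_upwards [eventually_ne_nhds hr] with y hy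
    simp only [morawetzF]
    field_simp
    ring
  rw [heq.deriv_eq, (((hasDerivAt_const_div_pow _ 2 hr).const_add 1).fun_add
    (hasDerivAt_const_div_pow _ 3 hr)).deriv]
  push_cast
  ring

theorem morawetzOmega_eq (M : ℝ) {r : ℝ} (hr : r ≠ 0) :
    morawetzOmega M r = 2 / r ^ 1 + -(4 * M) / r ^ 2 + 27 / 4 * M ^ 3 / r ^ 4
      + -(27 / 2 * M ^ 4) / r ^ 5 := by
  rw [morawetzOmega, deriv_morawetzF M hr, morawetzF]
  field_simp
  ring

theorem deriv_morawetzOmega (M : ℝ) {r : ℝ} (hr : r ≠ 0) :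
    deriv (morawetzOmega M) r = -2 / r ^ 2 + 8 * M / r ^ 3 + -(27 * M ^ 3) / r ^ 5
      + 135 / 2 * M ^ 4 / r ^ 6 := by
  have heq : morawetzOmega M =ᶠ[nhds r] fun y => 2 / y ^ 1 + -(4 * M) / y ^ 2
      + 27 / 4 * M ^ 3 / y ^ 4 + -(27 / 2 * M ^ 4) / y ^ 5 := by
    filter_upwards [eventually_ne_nhds hr] with y hy using morawetzOmega_eq M hy
  rw [heq.deriv_eq, ((((hasDerivAt_const_div_pow _ 1 hr).fun_add
    (hasDerivAt_const_div_pow _ 2 hr)).fun_add (hasDerivAt_const_div_pow _ 4 hr)).fun_add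
    (hasDerivAt_const_div_pow _ 5 hr)).deriv]
  push_cast
  ring

theorem deriv_deriv_morawetzOmega (M : ℝ) {r : ℝ} (hr : r ≠ 0) :
    deriv (deriv (morawetzOmega M)) r = 4 / r ^ 3 - 24 * M / r ^ 4 + 135 * M ^ 3 / r ^ 6
      - 405 * M ^ 4 / r ^ 7 := by
  have heq : deriv (morawetzOmega M) =ᶠ[nhds r] fun y => -2 / y ^ 2 + 8 * M / y ^ 3
      + -(27 * M ^ 3) / y ^ 5 + 135 / 2 * M ^ 4 / y ^ 6 := by
    filter_upwards [eventually_ne_nhds hr] with y hy using deriv_morawetzOmega M hy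
  rw [heq.deriv_eq, ((((hasDerivAt_const_div_pow _ 2 hr).fun_add
    (hasDerivAt_const_div_pow _ 3 hr)).fun_add (hasDerivAt_const_div_pow _ 5 hr)).fun_add
    (hasDerivAt_const_div_pow _ 6 hr)).deriv]
  push_cast
  ring

theorem deriv_schwarzschildV0 (M : ℝ) {r : ℝ} (hr : r ≠ 0) :
    deriv (schwarzschildV0 M) r = -2 / r ^ 3 + 6 * M / r ^ 4 := by
  have heq : schwarzschildV0 M =ᶠ[nhds r] fun y => 1 / y ^ 2 + -(2 * M) / y ^ 3 := by
    filter_upwards [eventually_ne_nhds hr] with y hy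
    simp only [schwarzschildV0]
    field_simp
    ring
  rw [heq.deriv_eq, ((hasDerivAt_const_div_pow _ 2 hr).fun_add
    (hasDerivAt_const_div_pow _ 3 hr)).deriv]
  push_cast
  ring

/-- For `M > 0` and every `r > 2M`, the zeroth-order Morawetz bulk coefficient identity
`−(1/4)□_M ω − (1/2) f (1 − 2M/r) V₀' − (M/r²) f V₀ + (f/r³)(1 − 3M/r)
  = (1/(4r³))(8 − 24(M/r) − 54(M/r)² + 108(M/r)³ + 513(M/r)⁴ − 891(M/r)⁵)`. -/
theorem morawetz_zeroth_order_identity (M : ℝ) (hM : 0 < M) :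
    ∀ r : ℝ, 2 * M < r →
      -(1 / 4) * radialBox M (morawetzOmega M) r
          - (1 / 2) * morawetzF M r * (1 - 2 * M / r) * deriv (schwarzschildV0 M) r
          - (M / r ^ 2) * morawetzF M r * schwarzschildV0 M r
          + (morawetzF M r / r ^ 3) * (1 - 3 * M / r)
        = (1 / (4 * r ^ 3)) *
            (8 - 24 * (M / r) - 54 * (M / r) ^ 2 + 108 * (M / r) ^ 3
              + 513 * (M / r) ^ 4 - 891 * (M / r) ^ 5) := by
  intro r hr
  have hr0 : r ≠ 0 := by linarith
  rw [radialBox, deriv_deriv_morawetzOmega M hr0, deriv_morawetzOmega M hr0,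
    deriv_schwarzschildV0 M hr0, morawetzF, schwarzschildV0]
  field_simp
  ring
end

section
/- Let M > 0 and define f(r) := (1 + 3M/r + 2M²/r²)(1 − 3M/r) for r > 2M. Then (i) f(r) = 1 − 7M²/r² − 6M³/r³ for all r > 2M; (ii) f is strictly increasing on (2M, ∞); and (iii) f(r)·(1 − 3M/r) ≥ 0 for all r > 2M. -/
/-- The Morawetz multiplier `f(r) = (1 + 3M/r + 2M²/r²)(1 − 3M/r)` used for `(H₁, H₂)`. -/
noncomputable def morawetzMultiplierH12 (M r : ℝ) : ℝ :=
  (1 + 3 * M / r + 2 * M ^ 2 / r ^ 2) * (1 - 3 * M / r)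

/-- Let `M > 0` and `f(r) = (1 + 3M/r + 2M²/r²)(1 − 3M/r)` for `r > 2M`. Then
(i) `f(r) = 1 − 7M²/r² − 6M³/r³`;
(ii) `f` is strictly increasing on `(2M, ∞)`;
(iii) `f(r)·(1 − 3M/r) ≥ 0` on `(2M, ∞)`. -/
theorem morawetzMultiplierH12_properties (M : ℝ) (hM : 0 < M) :
    (∀ r : ℝ, 2 * M < r →
        morawetzMultiplierH12 M r = 1 - 7 * M ^ 2 / r ^ 2 - 6 * M ^ 3 / r ^ 3) ∧
    StrictMonoOn (morawetzMultiplierH12 M) (Set.Ioi (2 * M)) ∧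
    (∀ r : ℝ, 2 * M < r → 0 ≤ morawetzMultiplierH12 M r * (1 - 3 * M / r)) := by
  have expand : ∀ r : ℝ,
      morawetzMultiplierH12 M r = 1 - 7 * M ^ 2 / r ^ 2 - 6 * M ^ 3 / r ^ 3 := by
    intro r
    unfold morawetzMultiplierH12
    ring
  refine ⟨fun r _ => expand r, ?_, ?_⟩
  · intro a ha b _ hab
    have ha0 : 0 < a := by linarith [Set.mem_Ioi.mp ha]
    rw [expand, expand]
    have h2 : 7 * M ^ 2 / b ^ 2 < 7 * M ^ 2 / a ^ 2 := by gcongr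
    have h3 : 6 * M ^ 3 / b ^ 3 < 6 * M ^ 3 / a ^ 3 := by gcongr
    linarith
  · intro r hr
    have hr0 : 0 < r := by linarith
    rw [morawetzMultiplierH12, mul_assoc]
    exact mul_nonneg (by positivity) (mul_self_nonneg _)
end

section
/- Let ℓ ≥ 3 be an integer and set λ := ℓ(ℓ+1). Then for every real h₁ ≥ 1, every real x with 0 < x ≤ 1/2, and all real numbers a, b not both zero, the quadratic form h₁·(λ + 4 − 18x)·a² + (1/2)·(λ − 2)·b² − 2·√(2λ − 4)·|a|·|b| is strictly positive. -/
/-- Let `ℓ ≥ 3` be an integer and `λ = ℓ(ℓ+1)`. For every `h₁ ≥ 1`, every `x` with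
`0 < x ≤ 1/2`, and all reals `a, b` not both zero, the quadratic form
`h₁(λ + 4 − 18x)a² + (1/2)(λ − 2)b² − 2√(2λ − 4)|a||b|` is strictly positive. -/
theorem T_energy_quadratic_form_pos (ℓ : ℕ) (hℓ : 3 ≤ ℓ) (h₁ : ℝ) (hh₁ : 1 ≤ h₁)
    (x : ℝ) (hx0 : 0 < x) (hx1 : x ≤ 1 / 2) (a b : ℝ) (hab : a ≠ 0 ∨ b ≠ 0) :
    0 < h₁ * ((ℓ : ℝ) * (ℓ + 1) + 4 - 18 * x) * a ^ 2
        + (1 / 2) * ((ℓ : ℝ) * (ℓ + 1) - 2) * b ^ 2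
        - 2 * Real.sqrt (2 * ((ℓ : ℝ) * (ℓ + 1)) - 4) * |a| * |b| := by
  have hl : (3 : ℝ) ≤ ℓ := by exact_mod_cast hℓ
  have hlam : (12 : ℝ) ≤ (ℓ : ℝ) * (ℓ + 1) := by nlinarith
  generalize (ℓ : ℝ) * (ℓ + 1) = lam at hlam ⊢
  have hA : 4 < h₁ * (lam + 4 - 18 * x) := by nlinarith
  have hs : Real.sqrt (2 * lam - 4) ^ 2 = 2 * lam - 4 := Real.sq_sqrt (by linarith)
  -- completing the square
  have key : h₁ * (lam + 4 - 18 * x) * a ^ 2 + (1 / 2) * (lam - 2) * b ^ 2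
      - 2 * Real.sqrt (2 * lam - 4) * |a| * |b|
      = (Real.sqrt (2 * lam - 4) * |b| / 2 - 2 * |a|) ^ 2
        + (h₁ * (lam + 4 - 18 * x) - 4) * a ^ 2 := by
    linear_combination (-b ^ 2 / 4) * hs - (Real.sqrt (2 * lam - 4) ^ 2 / 4) * sq_abs b
      - 4 * sq_abs a
  by_cases ha : a = 0
  · subst ha
    have hb : 0 < b ^ 2 := sq_pos_of_ne_zero (hab.resolve_left (absurd rfl))
    simp only [abs_zero]
    nlinarith
  · rw [key]
    have ha2 : 0 < a ^ 2 := sq_pos_of_ne_zero ha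
    exact add_pos_of_nonneg_of_pos (sq_nonneg _) (mul_pos (by linarith) ha2)
end

section
/- Let C ≥ 1 and let E₀, E₁, E₂ : [0, ∞) → [0, ∞) be continuous functions with E₀(τ) ≤ E₁(τ) ≤ E₂(τ) for all τ. Assume: (a) for each i ∈ {0, 1, 2} and all 0 ≤ τ₁ ≤ τ₂, E_i(τ₂) ≤ C·E_i(τ₁); and (b) for each i ∈ {1, 2} and all 0 ≤ τ₁ ≤ τ₂, ∫_{τ₁}^{τ₂} E_{i−1}(s) ds ≤ C·E_i(τ₁). Then there exists a constant C', depending only on C, such that E₀(τ) ≤ C'·E₂(0)·(1 + τ)^{−2} for all τ ≥ 0. -/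
open MeasureTheory intervalIntegral

/-- If `F` is almost monotone with constant `C` and its integral over `[a, b]` is at most `C * M`,
then `F b` is controlled by the average of `F` over `[a, b]`. -/
theorem sub_mul_le_of_integral_le {C M a b : ℝ} {F : ℝ → ℝ} (hC : 0 ≤ C) (hab : a ≤ b)
    (hF : ContinuousOn F (Set.Icc a b)) (hmono : ∀ s ∈ Set.Icc a b, F b ≤ C * F s)
    (hint : (∫ s in a..b, F s) ≤ C * M) : (b - a) * F b ≤ C ^ 2 * M := by
  have hFi : IntervalIntegrable F volume a b := hF.intervalIntegrable_of_Icc hab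
  calc (b - a) * F b = ∫ _ in a..b, F b := by simp
    _ ≤ ∫ s in a..b, C * F s :=
      integral_mono_on hab intervalIntegrable_const (hFi.const_mul C) hmono
    _ = C * ∫ s in a..b, F s := integral_const_mul C F
    _ ≤ C * (C * M) := by gcongr
    _ = C ^ 2 * M := by ring

/-- Abstract `r^p`-hierarchy pigeonhole lemma: given `C ≥ 1`, there exists `C'` depending
only on `C` such that whenever continuous nonnegative functions `E₀ ≤ E₁ ≤ E₂` on `[0, ∞)`
satisfy the almost-monotonicity bounds `E_i(τ₂) ≤ C·E_i(τ₁)` and the integrated hierarchy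
bounds `∫_{τ₁}^{τ₂} E_{i−1} ≤ C·E_i(τ₁)` for `i = 1, 2`, one has
`E₀(τ) ≤ C'·E₂(0)·(1 + τ)^{−2}` for all `τ ≥ 0`. -/
theorem hierarchy_decay (C : ℝ) (hC : 1 ≤ C) :
    ∃ C' : ℝ, 0 < C' ∧
      ∀ E₀ E₁ E₂ : ℝ → ℝ,
        ContinuousOn E₀ (Set.Ici (0 : ℝ)) →
        ContinuousOn E₁ (Set.Ici (0 : ℝ)) →
        ContinuousOn E₂ (Set.Ici (0 : ℝ)) →
        (∀ τ : ℝ, 0 ≤ τ → 0 ≤ E₀ τ) →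
        (∀ τ : ℝ, 0 ≤ τ → E₀ τ ≤ E₁ τ) →
        (∀ τ : ℝ, 0 ≤ τ → E₁ τ ≤ E₂ τ) →
        (∀ τ₁ τ₂ : ℝ, 0 ≤ τ₁ → τ₁ ≤ τ₂ →
          E₀ τ₂ ≤ C * E₀ τ₁ ∧ E₁ τ₂ ≤ C * E₁ τ₁ ∧ E₂ τ₂ ≤ C * E₂ τ₁) →
        (∀ τ₁ τ₂ : ℝ, 0 ≤ τ₁ → τ₁ ≤ τ₂ →
          (∫ s in τ₁..τ₂, E₀ s) ≤ C * E₁ τ₁ ∧ (∫ s in τ₁..τ₂, E₁ s) ≤ C * E₂ τ₁) →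
        ∀ τ : ℝ, 0 ≤ τ → E₀ τ ≤ C' * E₂ 0 * (1 + τ) ^ (-2 : ℤ) := by
  have hC0 : 0 ≤ C := by linarith
  refine ⟨2 * C + 8 * C ^ 4, by positivity, ?_⟩
  intro E₀ E₁ E₂ hE₀ hE₁ _ hnonneg h01 h12 hmono hint τ hτ
  have hhalf : 0 ≤ τ / 2 := by positivity
  have hle : τ / 2 ≤ τ := by linarith
  have decay₁ : (τ / 2 - 0) * E₁ (τ / 2) ≤ C ^ 2 * E₂ 0 :=
    sub_mul_le_of_integral_le hC0 hhalf (hE₁.mono Set.Icc_subset_Ici_self)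
      (fun s hs => (hmono s _ hs.1 hs.2).2.1) (hint 0 _ le_rfl hhalf).2
  have decay₀ : (τ - τ / 2) * E₀ τ ≤ C ^ 2 * E₁ (τ / 2) :=
    sub_mul_le_of_integral_le hC0 hle (hE₀.mono fun s hs => hhalf.trans hs.1)
      (fun s hs => (hmono s _ (hhalf.trans hs.1) hs.2).1) (hint _ _ hhalf hle).1
  have hbdd : E₀ τ ≤ C * E₂ 0 :=
    (hmono 0 τ le_rfl hτ).1.trans
      (mul_le_mul_of_nonneg_left ((h01 0 le_rfl).trans (h12 0 le_rfl)) hC0)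
  have hquad : τ ^ 2 * E₀ τ ≤ 4 * C ^ 4 * E₂ 0 := by
    have h₀ := mul_le_mul_of_nonneg_left decay₀ hhalf
    have h₁ := mul_le_mul_of_nonneg_left decay₁ (sq_nonneg C)
    linarith
  have hpos : 0 < (1 + τ) ^ 2 := by positivity
  rw [zpow_neg, ← div_eq_mul_inv]
  norm_cast
  rw [le_div_iff₀ hpos]
  have hE₀τ : 0 ≤ E₀ τ := hnonneg τ hτ
  nlinarith [mul_nonneg (sq_nonneg (1 - τ)) hE₀τ]
end
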